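/- arXiv:2206.05949 — 2 statements merged into one kernel-verified Lean document; each statement's English description precedes it below -/
import Mathlib

section
/- Let φ > 0, p > 0, B > 0, N₀ > 0, and let X be an exponentially distributed random variable with rate 1/φ (density (1/φ)e^{-x/φ} on [0, ∞)). Then E[ B · log₂(1 + p X / (B N₀)) ] = (B / ln 2) · e^{B N₀ / (p φ)} · ∫_{B N₀/(p φ)}^∞ e^{-t}/t dt. (Equivalently, the ergodic capacity equals -(B/ln 2) · e^{B N₀/(p φ)} · Ei(-B N₀/(p φ)), where Ei is the exponential integral.) -/
open MeasureTheory Real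

theorem setIntegral_Ioi_comp_add_right {E : Type*} [NormedAddCommGroup E] [NormedSpace ℝ E]
    (f : ℝ → E) (a b : ℝ) :
    ∫ x in Set.Ioi a, f (x + b) = ∫ x in Set.Ioi (a + b), f x := by
  have h := (measurePreserving_add_right volume b).setIntegral_preimage_emb
    (measurableEmbedding_addRight b) f (Set.Ioi (a + b))
  simpa using h

theorem log_one_add_div_nonneg {a x : ℝ} (ha : 0 < a) (hx : 0 ≤ x) :
    0 ≤ Real.log (1 + x / a) :=
  Real.log_nonneg (le_add_of_nonneg_right (by positivity))

theorem log_one_add_div_le {a x : ℝ} (ha : 0 < a) (hx : 0 ≤ x) :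
    Real.log (1 + x / a) ≤ x / a := by
  have := Real.log_le_sub_one_of_pos (show 0 < 1 + x / a by positivity)
  linarith

theorem integrableOn_log_one_add_div_mul_exp_neg {a : ℝ} (ha : 0 < a) :
    IntegrableOn (fun x => Real.log (1 + x / a) * Real.exp (-x)) (Set.Ioi 0) := by
  have hΓ : IntegrableOn (fun x : ℝ => a⁻¹ * (Real.exp (-x) * x ^ ((2 : ℝ) - 1))) (Set.Ioi 0) :=
    (Real.GammaIntegral_convergent two_pos).const_mul a⁻¹
  refine Integrable.mono' hΓ (by fun_prop) ?_
  filter_upwards [ae_restrict_mem measurableSet_Ioi] with x hx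
  have hx' : 0 ≤ x := le_of_lt hx
  rw [Real.norm_of_nonneg (mul_nonneg (log_one_add_div_nonneg ha hx') (Real.exp_pos _).le)]
  calc Real.log (1 + x / a) * Real.exp (-x) ≤ x / a * Real.exp (-x) := by
        gcongr
        exact log_one_add_div_le ha hx'
    _ = a⁻¹ * (Real.exp (-x) * x ^ ((2 : ℝ) - 1)) := by
        norm_num
        ring

theorem integrableOn_inv_add_mul_exp_neg {a : ℝ} (ha : 0 < a) :
    IntegrableOn (fun x => (a + x)⁻¹ * Real.exp (-x)) (Set.Ioi 0) := by
  refine Integrable.mono' ((integrableOn_exp_neg_Ioi 0).const_mul a⁻¹) (by fun_prop) ?_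
  filter_upwards [ae_restrict_mem measurableSet_Ioi] with x hx
  have hx' : 0 < x := hx
  rw [Real.norm_of_nonneg (by positivity)]
  gcongr
  linarith

theorem tendsto_log_one_add_div_mul_exp_neg_atTop {a : ℝ} (ha : 0 < a) :
    Filter.Tendsto (fun x => Real.log (1 + x / a) * Real.exp (-x)) Filter.atTop (nhds 0) := by
  have hlim : Filter.Tendsto (fun x : ℝ => a⁻¹ * (x ^ 1 * Real.exp (-x))) Filter.atTop (nhds 0) := by
    simpa using (Real.tendsto_pow_mul_exp_neg_atTop_nhds_zero 1).const_mul a⁻¹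
  refine squeeze_zero' ?_ ?_ hlim
  · filter_upwards [Filter.eventually_ge_atTop 0] with x hx
    exact mul_nonneg (log_one_add_div_nonneg ha hx) (Real.exp_pos _).le
  · filter_upwards [Filter.eventually_ge_atTop 0] with x hx
    calc Real.log (1 + x / a) * Real.exp (-x) ≤ x / a * Real.exp (-x) := by
          gcongr
          exact log_one_add_div_le ha hx
      _ = a⁻¹ * (x ^ 1 * Real.exp (-x)) := by ring

theorem integral_log_one_add_div_mul_exp_neg {a : ℝ} (ha : 0 < a) :
    ∫ x in Set.Ioi (0 : ℝ), Real.log (1 + x / a) * Real.exp (-x) =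
      ∫ x in Set.Ioi (0 : ℝ), (a + x)⁻¹ * Real.exp (-x) := by
  have hu : ∀ x ∈ Set.Ioi (0 : ℝ),
      HasDerivAt (fun x => Real.log (1 + x / a)) ((a + x)⁻¹) x := by
    intro x hx
    have hx' : 0 < x := hx
    have h := (((hasDerivAt_id' x).div_const a).const_add 1).log
      (show 1 + x / a ≠ 0 by positivity)
    convert h using 1
    field_simp
  have hv : ∀ x ∈ Set.Ioi (0 : ℝ), HasDerivAt (fun x => -Real.exp (-x)) (Real.exp (-x)) x := by
    intro x _
    simpa using (hasDerivAt_neg x).exp.fun_neg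
  have h_zero : Filter.Tendsto ((fun x => Real.log (1 + x / a)) * fun x => -Real.exp (-x))
      (nhdsWithin 0 (Set.Ioi 0)) (nhds 0) := by
    have hc : ContinuousAt ((fun x => Real.log (1 + x / a)) * fun x => -Real.exp (-x)) 0 := by
      refine ContinuousAt.mul (ContinuousAt.log (by fun_prop) (by simp)) (by fun_prop)
    have := hc.tendsto.mono_left (nhdsWithin_le_nhds (s := Set.Ioi 0))
    simpa using this
  have h_infty : Filter.Tendsto ((fun x => Real.log (1 + x / a)) * fun x => -Real.exp (-x))
      Filter.atTop (nhds 0) := by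
    simpa [Pi.mul_def] using (tendsto_log_one_add_div_mul_exp_neg_atTop ha).neg
  have h := integral_Ioi_mul_deriv_eq_deriv_mul hu hv
    (integrableOn_log_one_add_div_mul_exp_neg ha)
    (by simpa [Pi.mul_def] using (integrableOn_inv_add_mul_exp_neg ha).neg) h_zero h_infty
  simpa [integral_neg] using h

theorem integral_inv_add_mul_exp_neg (a : ℝ) :
    ∫ x in Set.Ioi (0 : ℝ), (a + x)⁻¹ * Real.exp (-x) =
      Real.exp a * ∫ t in Set.Ioi a, Real.exp (-t) / t := by
  have h := setIntegral_Ioi_comp_add_right (fun t => Real.exp (-t) / t) 0 a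
  rw [zero_add] at h
  rw [← h, ← integral_const_mul]
  congr 1 with x
  have hexp : Real.exp (-x) = Real.exp a * Real.exp (-(x + a)) := by
    rw [← Real.exp_add]
    ring_nf
  rw [hexp, add_comm a x]
  ring

/-- Closed-form ergodic capacity of a Rayleigh fading channel: if `X` has the
exponential density `(1/φ) e^{-x/φ}` on `[0, ∞)`, then
`E[B log₂(1 + p X/(B N₀))] = (B/ln 2) · e^{B N₀/(p φ)} · ∫_{B N₀/(p φ)}^∞ e^{-t}/t dt`. -/
theorem ergodic_capacity_closed_form
    (φ p B N₀ : ℝ) (hφ : 0 < φ) (hp : 0 < p) (hB : 0 < B) (hN₀ : 0 < N₀) :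
    ∫ x in Set.Ioi (0 : ℝ),
        (1 / φ) * Real.exp (-x / φ) * (B * Real.logb 2 (1 + p * x / (B * N₀)))
      = (B / Real.log 2) * Real.exp (B * N₀ / (p * φ)) *
          ∫ t in Set.Ioi (B * N₀ / (p * φ)), Real.exp (-t) / t := by
  have ha : 0 < B * N₀ / (p * φ) := by positivity
  have hscale := integral_comp_mul_left_Ioi'
    (fun x => (1 / φ) * Real.exp (-x / φ) * (B * Real.logb 2 (1 + p * x / (B * N₀)))) 0 hφ
  rw [mul_zero] at hscale
  rw [← hscale, smul_eq_mul, mul_assoc (B / Real.log 2), ← integral_inv_add_mul_exp_neg,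
    ← integral_log_one_add_div_mul_exp_neg ha, ← integral_const_mul, ← integral_const_mul]
  congr 1 with x
  have hexp : -(φ * x) / φ = -x := by field_simp
  have hlog : p * (φ * x) / (B * N₀) = x / (B * N₀ / (p * φ)) := by field_simp
  rw [hexp, hlog, Real.logb]
  field_simp
end

section
/- Fix a > 0. The function C(p) = e^{a/p} · ∫_{a/p}^∞ e^{-t}/t dt is strictly increasing in p on (0, ∞). Equivalently, the function y ↦ e^{y} · ∫_{y}^∞ e^{-t}/t dt is strictly decreasing on (0, ∞). -/
open MeasureTheory Real

theorem exp_mul_integral_Ioi_exp_neg_div (y : ℝ) :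
    Real.exp y * ∫ t in Set.Ioi y, Real.exp (-t) / t =
      ∫ s in Set.Ioi (0 : ℝ), Real.exp (-s) / (s + y) := by
  have h := (measurePreserving_add_right volume y).setIntegral_preimage_emb
    (measurableEmbedding_addRight y) (fun t => Real.exp (-t) / t) (Set.Ioi y)
  rw [← h, ← integral_const_mul, Set.preimage_add_const_Ioi, sub_self]
  congr 1 with s
  rw [← mul_div_assoc, ← Real.exp_add]
  congr 2
  ring

theorem integrableOn_exp_neg_div_add {y : ℝ} (hy : 0 < y) :
    IntegrableOn (fun s => Real.exp (-s) / (s + y)) (Set.Ioi 0) := by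
  refine ((integrableOn_exp_neg_Ioi 0).div_const y).mono' (Measurable.aestronglyMeasurable (by fun_prop)) ?_
  filter_upwards [ae_restrict_mem measurableSet_Ioi] with s (hs : 0 < s)
  rw [Real.norm_of_nonneg (by positivity)]
  gcongr
  linarith

theorem exp_mul_integral_Ioi_exp_neg_div_strictAntiOn :
    StrictAntiOn
      (fun y : ℝ => Real.exp y * ∫ t in Set.Ioi y, Real.exp (-t) / t)
      (Set.Ioi 0) := by
  intro x (hx : 0 < x) y (hy : 0 < y) hxy
  simp only [exp_mul_integral_Ioi_exp_neg_div]
  have hpos : ∀ s ∈ Set.Ioi (0 : ℝ),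
      0 < Real.exp (-s) / (s + x) - Real.exp (-s) / (s + y) := by
    intro s (hs : 0 < s)
    rw [sub_pos]
    gcongr
  have hix := integrableOn_exp_neg_div_add hx
  have hiy := integrableOn_exp_neg_div_add hy
  rw [← sub_pos, ← integral_sub hix hiy, setIntegral_pos_iff_support_of_nonneg_ae
    ((ae_restrict_mem measurableSet_Ioi).mono fun s hs => (hpos s hs).le) (hix.sub hiy),
    Set.inter_eq_right.mpr fun s hs => Function.mem_support.mpr (hpos s hs).ne']
  simp

/-- For `a > 0`, the map `p ↦ e^{a/p} ∫_{a/p}^∞ e^{-t}/t dt` is strictly increasing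
on `(0, ∞)`; equivalently, `y ↦ e^{y} ∫_{y}^∞ e^{-t}/t dt` is strictly decreasing
on `(0, ∞)`. -/
theorem ergodic_capacity_strictMono (a : ℝ) (ha : 0 < a) :
    StrictMonoOn
        (fun p : ℝ => Real.exp (a / p) * ∫ t in Set.Ioi (a / p), Real.exp (-t) / t)
        (Set.Ioi 0) ∧
    StrictAntiOn
        (fun y : ℝ => Real.exp y * ∫ t in Set.Ioi y, Real.exp (-t) / t)
        (Set.Ioi 0) := by
  refine ⟨fun p (hp : 0 < p) q (hq : 0 < q) hpq => ?_,
    exp_mul_integral_Ioi_exp_neg_div_strictAntiOn⟩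
  exact exp_mul_integral_Ioi_exp_neg_div_strictAntiOn (div_pos ha hq) (div_pos ha hp)
    (div_lt_div_of_pos_left ha hp hpq)
end
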